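/- For every positive integer n, there exist nonnegative integers γ_{n,k}, for 0 ≤ k ≤ ⌊(n-1)/2⌋, such that the Eulerian polynomial A_n(t) = Σ_{σ ∈ S_n} t^{des σ} satisfies A_n(t) = Σ_{k=0}^{⌊(n-1)/2⌋} γ_{n,k} · t^k · (1+t)^{n-1-2k}. -/

import Mathlib

open Finset MvPolynomial

/-- The value `σ(i)` for a permutation of `{1,…,n}` encoded as `Equiv.Perm (Fin n)`,
with the convention `σ(i) = 0` for `i = 0` and `i = n+1` (indeed for all `i ∉ [n]`). -/
def pval (n : ℕ) (σ : Equiv.Perm (Fin n)) (i : ℕ) : ℕ :=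
  if h : 1 ≤ i ∧ i ≤ n then ((σ ⟨i - 1, by omega⟩ : Fin n) : ℕ) + 1 else 0

/-- Number of inversions: pairs `1 ≤ i < j ≤ n` with `σ(i) > σ(j)`. -/
def inv (n : ℕ) (σ : Equiv.Perm (Fin n)) : ℕ :=
  ((Finset.Icc 1 n ×ˢ Finset.Icc 1 n).filter
    (fun p => p.1 < p.2 ∧ pval n σ p.2 < pval n σ p.1)).card

/-- Number of excedances: indices `i ∈ [n]` with `i < σ(i)`. -/
def exc (n : ℕ) (σ : Equiv.Perm (Fin n)) : ℕ :=
  ((Finset.Icc 1 n).filter (fun i => i < pval n σ i)).card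

/-- Number of drops: indices `i ∈ [n]` with `i > σ(i)`. -/
def drp (n : ℕ) (σ : Equiv.Perm (Fin n)) : ℕ :=
  ((Finset.Icc 1 n).filter (fun i => pval n σ i < i)).card

/-- Number of descents: indices `1 ≤ i < n` with `σ(i) > σ(i+1)`. -/
def des (n : ℕ) (σ : Equiv.Perm (Fin n)) : ℕ :=
  ((Finset.Icc 1 (n - 1)).filter (fun i => pval n σ (i + 1) < pval n σ i)).card

/-- `les σ`: number of pairs `2 ≤ i < j ≤ n` with `σ(i-1) > σ(j) > σ(i)`. -/
def les (n : ℕ) (σ : Equiv.Perm (Fin n)) : ℕ :=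
  ((Finset.Icc 2 n ×ˢ Finset.Icc 2 n).filter
    (fun p => p.1 < p.2 ∧ pval n σ p.2 < pval n σ (p.1 - 1) ∧
      pval n σ p.1 < pval n σ p.2)).card

/-- `res σ`: number of pairs `1 ≤ i < j ≤ n-1` with `σ(j+1) > σ(i) > σ(j)`. -/
def res (n : ℕ) (σ : Equiv.Perm (Fin n)) : ℕ :=
  ((Finset.Icc 1 (n - 1) ×ˢ Finset.Icc 1 (n - 1)).filter
    (fun p => p.1 < p.2 ∧ pval n σ p.2 < pval n σ p.1 ∧
      pval n σ p.1 < pval n σ (p.2 + 1))).card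

/-- `ress σ`: number of pairs `1 ≤ i < j ≤ n-1` with `σ(j+1) < σ(i) < σ(j)`. -/
def ress (n : ℕ) (σ : Equiv.Perm (Fin n)) : ℕ :=
  ((Finset.Icc 1 (n - 1) ×ˢ Finset.Icc 1 (n - 1)).filter
    (fun p => p.1 < p.2 ∧ pval n σ (p.2 + 1) < pval n σ p.1 ∧
      pval n σ p.1 < pval n σ p.2)).card

/-- Crossing number: pairs `(i,j) ∈ [n]×[n]` with `i < j ≤ σ(i) < σ(j)` or
`i > j > σ(i) > σ(j)`. -/
def cros (n : ℕ) (σ : Equiv.Perm (Fin n)) : ℕ :=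
  ((Finset.Icc 1 n ×ˢ Finset.Icc 1 n).filter
    (fun p => (p.1 < p.2 ∧ p.2 ≤ pval n σ p.1 ∧ pval n σ p.1 < pval n σ p.2) ∨
      (p.2 < p.1 ∧ pval n σ p.1 < p.2 ∧ pval n σ p.2 < pval n σ p.1))).card

/-- Nesting number: pairs `(i,j) ∈ [n]×[n]` with `i < j ≤ σ(j) < σ(i)` or
`i > j > σ(j) > σ(i)`. -/
def nest (n : ℕ) (σ : Equiv.Perm (Fin n)) : ℕ :=
  ((Finset.Icc 1 n ×ˢ Finset.Icc 1 n).filter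
    (fun p => (p.1 < p.2 ∧ p.2 ≤ pval n σ p.2 ∧ pval n σ p.2 < pval n σ p.1) ∨
      (p.2 < p.1 ∧ pval n σ p.2 < p.2 ∧ pval n σ p.1 < pval n σ p.2))).card

/-- Number of valleys: `i ∈ [n]` with `σ(i-1) > σ(i)` and `σ(i) < σ(i+1)`
(convention `σ(0) = σ(n+1) = 0`). -/
def valleys (n : ℕ) (σ : Equiv.Perm (Fin n)) : ℕ :=
  ((Finset.Icc 1 n).filter
    (fun i => pval n σ i < pval n σ (i - 1) ∧ pval n σ i < pval n σ (i + 1))).card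

/-- Number of double descents: `i ∈ [n]` with `σ(i-1) > σ(i)` and `σ(i) > σ(i+1)`
(convention `σ(0) = σ(n+1) = 0`). -/
def ddes (n : ℕ) (σ : Equiv.Perm (Fin n)) : ℕ :=
  ((Finset.Icc 1 n).filter
    (fun i => pval n σ i < pval n σ (i - 1) ∧ pval n σ (i + 1) < pval n σ i)).card

/-- `S_{n,k}`: permutations of `[n]` with exactly `k` valleys and no double descents. -/
def Snk (n k : ℕ) : Finset (Equiv.Perm (Fin n)) :=
  Finset.univ.filter (fun σ => valleys n σ = k ∧ ddes n σ = 0)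

/-- If `w'` is obtained from the word `w` by inserting, right after position `p`, a letter exceeding
its two neighbours, then `w'` has one more descent, unless `p` is itself a descent of `w`. -/
lemma card_descents_insert (w w' : ℕ → ℕ) (p q : ℕ) (hlow : ∀ i ≤ p, w' i = w i)
    (hhigh : ∀ i, p + 1 ≤ i → w' (i + 1) = w i) (hleft : w p < w' (p + 1))
    (hright : w (p + 1) < w' (p + 1)) :
    #{i ∈ range (p + 1 + 1 + q) | w' (i + 1) < w' i} + (if w (p + 1) < w p then 1 else 0) =
      #{i ∈ range (p + 1 + q) | w (i + 1) < w i} + 1 := by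
  simp only [Finset.card_filter, Finset.sum_range_add, Finset.sum_range_succ]
  have e1 : ∑ i ∈ range p, (if w' (i + 1) < w' i then 1 else 0) =
      ∑ i ∈ range p, (if w (i + 1) < w i then 1 else 0) := by
    refine Finset.sum_congr rfl fun i hi => ?_
    rw [Finset.mem_range] at hi
    rw [hlow i hi.le, hlow (i + 1) hi]
  have e2 : ∑ i ∈ range q, (if w' (p + 1 + 1 + i + 1) < w' (p + 1 + 1 + i) then 1 else 0) =
      ∑ i ∈ range q, (if w (p + 1 + i + 1) < w (p + 1 + i) then 1 else 0) := by
    refine Finset.sum_congr rfl fun i _ => ?_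
    rw [show p + 1 + 1 + i + 1 = (p + 1 + i + 1) + 1 by ring, hhigh _ (by omega),
      show p + 1 + 1 + i = (p + 1 + i) + 1 by ring, hhigh _ (by omega)]
  rw [e1, e2, hlow p le_rfl, hhigh (p + 1) le_rfl, if_neg (not_lt.2 hleft.le), if_pos hright]
  ring

/-- Since `σ(0) = σ(n+1) = 0`, allowing the indices `0` and `n` adds one descent, at `n`. -/
lemma card_descents_range (n : ℕ) (hn : 0 < n) (σ : Equiv.Perm (Fin n)) :
    #{i ∈ range (n + 1) | pval n σ (i + 1) < pval n σ i} = des n σ + 1 := by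
  have h : {i ∈ range (n + 1) | pval n σ (i + 1) < pval n σ i} =
      insert n {i ∈ Finset.Icc 1 (n - 1) | pval n σ (i + 1) < pval n σ i} := by
    ext i
    simp only [Finset.mem_filter, Finset.mem_range, Finset.mem_insert, Finset.mem_Icc]
    constructor
    · rintro ⟨h1, h2⟩
      have h0 : i ≠ 0 := by
        rintro rfl
        simp [pval] at h2
      by_cases hi : i = n
      · exact Or.inl hi
      · exact Or.inr ⟨by omega, h2⟩
    · rintro (rfl | ⟨h1, h2⟩)
      · refine ⟨by omega, ?_⟩
        simp only [pval]
        rw [dif_neg (by omega), dif_pos ⟨hn, le_rfl⟩]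
        omega
      · exact ⟨by omega, h2⟩
  rw [h, Finset.card_insert_of_notMem (by simp; omega), des]

/-- Insert the maximal letter in position `p` (counted from `0`) of the word of `σ`. -/
def insertMax {n : ℕ} (p : Fin (n + 1)) (σ : Equiv.Perm (Fin n)) : Equiv.Perm (Fin (n + 1)) :=
  ((finSuccEquiv' p).trans (Equiv.optionCongr σ)).trans (finSuccEquiv' (Fin.last n)).symm

@[simp]
lemma insertMax_self {n : ℕ} (p : Fin (n + 1)) (σ : Equiv.Perm (Fin n)) :
    insertMax p σ p = Fin.last n := by
  simp [insertMax]

@[simp]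
lemma insertMax_succAbove {n : ℕ} (p : Fin (n + 1)) (σ : Equiv.Perm (Fin n)) (i : Fin n) :
    insertMax p σ (p.succAbove i) = (σ i).castSucc := by
  simp [insertMax]

lemma bijective_insertMax (n : ℕ) :
    Function.Bijective fun x : Fin (n + 1) × Equiv.Perm (Fin n) => insertMax x.1 x.2 := by
  rw [Fintype.bijective_iff_injective_and_card]
  refine ⟨?_, by simp [Fintype.card_perm, Nat.factorial_succ]⟩
  rintro ⟨p, σ⟩ ⟨q, τ⟩ h
  have hpq : p = q := by
    apply (insertMax q τ).injective
    rw [insertMax_self, ← insertMax_self p σ]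
    exact (congrArg (fun f : Equiv.Perm _ => f p) h).symm
  subst hpq
  have hστ : σ = τ := by
    ext i
    have := congrArg (fun f : Equiv.Perm _ => f (p.succAbove i)) h
    simpa using congrArg Fin.val this
  rw [hστ]

lemma pval_zero (n : ℕ) (σ : Equiv.Perm (Fin n)) : pval n σ 0 = 0 := by
  simp [pval]

lemma pval_succ {n : ℕ} (σ : Equiv.Perm (Fin n)) (i : Fin n) : pval n σ (i + 1) = σ i + 1 := by
  simp [pval]

lemma pval_of_lt {n : ℕ} (σ : Equiv.Perm (Fin n)) {i : ℕ} (hi : n < i) : pval n σ i = 0 := by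
  simp [pval, hi]

lemma pval_le (n : ℕ) (σ : Equiv.Perm (Fin n)) (i : ℕ) : pval n σ i ≤ n := by
  unfold pval
  split_ifs
  · exact (σ _).isLt
  · exact Nat.zero_le _

lemma pval_insertMax_self {n : ℕ} (p : Fin (n + 1)) (σ : Equiv.Perm (Fin n)) :
    pval (n + 1) (insertMax p σ) (p + 1) = n + 1 := by
  simp [pval_succ]

lemma pval_insertMax_of_le {n : ℕ} (p : Fin (n + 1)) (σ : Equiv.Perm (Fin n)) {i : ℕ}
    (hi : i ≤ p) : pval (n + 1) (insertMax p σ) i = pval n σ i := by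
  obtain _ | j := i
  · simp only [pval_zero]
  · have hj : j < n := by omega
    have hs : p.succAbove ⟨j, hj⟩ = Fin.castSucc ⟨j, hj⟩ :=
      Fin.succAbove_of_castSucc_lt _ _ (by simpa [Fin.lt_def] using hi)
    have h := insertMax_succAbove p σ ⟨j, hj⟩
    have h1 := pval_succ (insertMax p σ) (p.succAbove ⟨j, hj⟩)
    have h2 := pval_succ σ ⟨j, hj⟩
    rw [h, hs] at h1
    simp only [Fin.val_castSucc] at h1
    rw [h1, h2]

lemma pval_insertMax_of_lt {n : ℕ} (p : Fin (n + 1)) (σ : Equiv.Perm (Fin n)) {i : ℕ}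
    (hi : p + 1 ≤ i) : pval (n + 1) (insertMax p σ) (i + 1) = pval n σ i := by
  obtain _ | j := i
  · omega
  · obtain hj | hj := lt_or_ge j n
    · have hs : p.succAbove ⟨j, hj⟩ = Fin.succ ⟨j, hj⟩ :=
        Fin.succAbove_of_le_castSucc _ _ (by simp [Fin.le_def]; omega)
      have h := insertMax_succAbove p σ ⟨j, hj⟩
      have h1 := pval_succ (insertMax p σ) (p.succAbove ⟨j, hj⟩)
      have h2 := pval_succ σ ⟨j, hj⟩
      rw [h, hs] at h1
      simp only [Fin.val_castSucc, Fin.val_succ] at h1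
      rw [h1, h2]
    · rw [pval_of_lt _ (by omega), pval_of_lt _ (by omega)]

lemma des_insertMax {n : ℕ} (hn : 0 < n) (p : Fin (n + 1)) (σ : Equiv.Perm (Fin n)) :
    des (n + 1) (insertMax p σ) + (if pval n σ (p + 1) < pval n σ p then 1 else 0) =
      des n σ + 1 := by
  obtain ⟨q, hq⟩ := Nat.exists_eq_add_of_lt p.isLt
  have key := card_descents_insert (pval n σ) (pval (n + 1) (insertMax p σ)) p q
    (fun i => pval_insertMax_of_le p σ) (fun i => pval_insertMax_of_lt p σ)
    (by rw [pval_insertMax_self]; exact Nat.lt_succ_of_le (pval_le n σ _))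
    (by rw [pval_insertMax_self]; exact Nat.lt_succ_of_le (pval_le n σ _))
  rw [show (p : ℕ) + 1 + 1 + q = n + 1 + 1 by omega, show (p : ℕ) + 1 + q = n + 1 by omega,
    card_descents_range n hn, card_descents_range (n + 1) n.succ_pos] at key
  omega

/-- The Eulerian polynomial, as the descent generating function of permutations of `[n]`. -/
noncomputable def eulerianPoly (n : ℕ) : Polynomial ℤ :=
  ∑ σ : Equiv.Perm (Fin n), Polynomial.X ^ des n σ

/-- The operator `f ↦ (1 + n X) f + X (1 - X) f'` sending `A_n` to `A_{n+1}`. -/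
noncomputable def eulerianStep (n : ℕ) : Polynomial ℤ →+ Polynomial ℤ where
  toFun f := (1 + (n : Polynomial ℤ) * Polynomial.X) * f +
    Polynomial.X * (1 - Polynomial.X) * Polynomial.derivative f
  map_zero' := by simp
  map_add' f g := by
    simp only [Polynomial.derivative_add]
    ring

lemma eulerianStep_apply (n : ℕ) (f : Polynomial ℤ) :
    eulerianStep n f = (1 + (n : Polynomial ℤ) * Polynomial.X) * f +
      Polynomial.X * (1 - Polynomial.X) * Polynomial.derivative f :=
  rfl

lemma eulerianStep_X_pow (n d : ℕ) :
    eulerianStep n (Polynomial.X ^ d) = ((n : Polynomial ℤ) + 1) * Polynomial.X ^ (d + 1) +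
      ((d : Polynomial ℤ) + 1) * (Polynomial.X ^ d - Polynomial.X ^ (d + 1)) := by
  rw [eulerianStep_apply]
  obtain _ | d := d
  · simp
    ring
  · simp only [Polynomial.derivative_X_pow, Nat.add_sub_cancel]
    push_cast
    simp only [map_add, map_natCast, map_one]
    ring

lemma sum_X_pow_des_insertMax {n : ℕ} (hn : 0 < n) (σ : Equiv.Perm (Fin n)) :
    ∑ p : Fin (n + 1), (Polynomial.X : Polynomial ℤ) ^ des (n + 1) (insertMax p σ) =
      eulerianStep n (Polynomial.X ^ des n σ) := by
  have h (p : Fin (n + 1)) : (Polynomial.X : Polynomial ℤ) ^ des (n + 1) (insertMax p σ) =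
      Polynomial.X ^ (des n σ + 1) + (if pval n σ (p + 1) < pval n σ p then 1 else 0) *
        (Polynomial.X ^ des n σ - Polynomial.X ^ (des n σ + 1)) := by
    have hp := des_insertMax hn p σ
    split_ifs at hp ⊢
    · rw [Nat.add_right_cancel hp]
      ring
    · rw [← hp]
      simp
  have hc := congrArg (Nat.cast : ℕ → Polynomial ℤ) (card_descents_range n hn σ)
  rw [Finset.natCast_card_filter, Finset.sum_range] at hc
  rw [Finset.sum_congr rfl fun p _ => h p, Finset.sum_add_distrib, ← Finset.sum_mul, hc,
    eulerianStep_X_pow]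
  simp

lemma eulerianPoly_succ {n : ℕ} (hn : 0 < n) :
    eulerianPoly (n + 1) = eulerianStep n (eulerianPoly n) := by
  rw [eulerianPoly, eulerianPoly, map_sum, ← (bijective_insertMax n).sum_comp,
    Fintype.sum_prod_type_right]
  exact Finset.sum_congr rfl fun σ _ => sum_X_pow_des_insertMax hn σ

/-- The γ-nonnegative polynomials with center of symmetry `m / 2`. -/
noncomputable def gammaCone (m : ℕ) : AddSubmonoid (Polynomial ℤ) :=
  AddSubmonoid.closure
    {f | ∃ k d, 2 * k + d = m ∧ f = Polynomial.X ^ k * (1 + Polynomial.X) ^ d}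

lemma X_pow_mul_mem_gammaCone (k d : ℕ) :
    (Polynomial.X : Polynomial ℤ) ^ k * (1 + Polynomial.X) ^ d ∈ gammaCone (2 * k + d) :=
  AddSubmonoid.subset_closure ⟨k, d, rfl, rfl⟩

lemma eulerianStep_X_pow_mul (k d : ℕ) :
    eulerianStep (2 * k + d + 2) (Polynomial.X ^ k * (1 + Polynomial.X) ^ (d + 1)) =
      (k + 1) • (Polynomial.X ^ k * (1 + Polynomial.X) ^ (d + 2)) +
        (2 * (d + 1)) • (Polynomial.X ^ (k + 1) * (1 + Polynomial.X) ^ d) := by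
  rw [eulerianStep_apply]
  obtain _ | k := k
  · simp [Polynomial.derivative_pow]
    ring
  · simp [Polynomial.derivative_pow]
    ring

lemma eulerianStep_X_pow_self (k : ℕ) :
    eulerianStep (2 * k + 1) (Polynomial.X ^ k) =
      (k + 1) • (Polynomial.X ^ k * (1 + Polynomial.X) ^ 1) := by
  rw [eulerianStep_X_pow, nsmul_eq_mul]
  push_cast
  ring

lemma eulerianStep_mem_gammaCone {m : ℕ} {f : Polynomial ℤ} (hf : f ∈ gammaCone m) :
    eulerianStep (m + 1) f ∈ gammaCone (m + 1) := by
  suffices h : gammaCone m ≤ (gammaCone (m + 1)).comap (eulerianStep (m + 1)) from h hf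
  refine (AddSubmonoid.closure_le).2 ?_
  rintro _ ⟨k, d, rfl, rfl⟩
  change eulerianStep _ _ ∈ gammaCone _
  obtain _ | d := d
  · simp only [add_zero, pow_zero, mul_one]
    rw [eulerianStep_X_pow_self]
    exact nsmul_mem (X_pow_mul_mem_gammaCone k 1) _
  · rw [show 2 * k + (d + 1) + 1 = 2 * k + d + 2 by ring, eulerianStep_X_pow_mul]
    refine add_mem (nsmul_mem (X_pow_mul_mem_gammaCone k (d + 2)) _) (nsmul_mem ?_ _)
    rw [show 2 * k + d + 2 = 2 * (k + 1) + d by ring]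
    exact X_pow_mul_mem_gammaCone (k + 1) d

lemma exists_gamma_of_mem_gammaCone {m : ℕ} {f : Polynomial ℤ} (hf : f ∈ gammaCone m) :
    ∃ γ : ℕ → ℕ, f = ∑ k ∈ Finset.range (m / 2 + 1),
      (γ k : Polynomial ℤ) * Polynomial.X ^ k * (1 + Polynomial.X) ^ (m - 2 * k) := by
  refine AddSubmonoid.closure_induction ?_ ⟨0, by simp⟩ ?_ hf
  · rintro _ ⟨k, d, rfl, rfl⟩
    refine ⟨fun i => if i = k then 1 else 0, ?_⟩
    rw [Finset.sum_eq_single k (fun i _ hi => by simp [hi])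
      (fun h => absurd (Finset.mem_range.2 (by omega)) h)]
    simp
  · rintro _ _ _ _ ⟨γ, rfl⟩ ⟨δ, rfl⟩
    refine ⟨γ + δ, ?_⟩
    rw [← Finset.sum_add_distrib]
    refine Finset.sum_congr rfl fun k _ => ?_
    simp only [Pi.add_apply, Nat.cast_add]
    ring

lemma eulerianPoly_mem_gammaCone (m : ℕ) : eulerianPoly (m + 1) ∈ gammaCone m := by
  induction m with
  | zero => simpa [eulerianPoly, des] using X_pow_mul_mem_gammaCone 0 0
  | succ m ih =>
    rw [eulerianPoly_succ m.succ_pos]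
    exact eulerianStep_mem_gammaCone ih

/-- The Eulerian polynomial `A_n(t) = Σ_σ t^(des σ)` has a γ-expansion
with nonnegative integer coefficients. -/
theorem statement12 (n : ℕ) (hn : 0 < n) :
    ∃ γ : ℕ → ℕ,
      (∑ σ : Equiv.Perm (Fin n), (Polynomial.X : Polynomial ℤ) ^ (des n σ)) =
      ∑ k ∈ Finset.range ((n - 1) / 2 + 1),
        (γ k : Polynomial ℤ) * Polynomial.X ^ k * (1 + Polynomial.X) ^ (n - 1 - 2 * k) := by
  obtain ⟨m, rfl⟩ := Nat.exists_eq_succ_of_ne_zero hn.ne'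
  exact exists_gamma_of_mem_gammaCone (eulerianPoly_mem_gammaCone m)
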